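/- arXiv:0808.3421 — 2 statements merged into one kernel-verified Lean document; each statement's English description precedes it below -/
import Mathlib

section
/- Let Ω ⊆ ℂⁿ be a bounded domain and let Φ : Ω → Ω be a holomorphic map that is injective and surjective. Then the inverse map Φ⁻¹ : Ω → Ω is holomorphic. -/
section

open Filter Metric Set
open scoped Topology

/-- Persistence of zeros: if `H x₀` vanishes at the center of a disc but not on its boundary, then
`H x` has a zero in the closed disc for all `x` near `x₀`. -/
theorem eventually_exists_zero_of_ne_zero_on_sphere {X : Type*} [TopologicalSpace X]
    {H : X → ℂ → ℂ} {x₀ : X} {c : ℂ} {r : ℝ} (hr : 0 < r)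
    (hd : ∀ᶠ x in 𝓝 x₀, DiffContOnCl ℂ (H x) (ball c r))
    (h₀ : H x₀ c = 0) (hc : ContinuousAt (fun x => H x c) x₀)
    (hs : ∀ s ∈ sphere c r, ContinuousAt (fun y : X × ℂ => H y.1 y.2) (x₀, s))
    (hne : ∀ s ∈ sphere c r, H x₀ s ≠ 0) :
    ∀ᶠ x in 𝓝 x₀, ∃ s ∈ closedBall c r, H x s = 0 := by
  have hcomp : IsCompact (sphere c r) := isCompact_sphere c r
  have hcont : ContinuousOn (fun s => ‖H x₀ s‖) (sphere c r) := fun s hsr => by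
    have h1 : ContinuousAt (fun s : ℂ => H x₀ s) s :=
      ContinuousAt.comp (f := fun s : ℂ => (x₀, s)) (hs s hsr) (by fun_prop)
    exact h1.norm.continuousWithinAt
  obtain ⟨s₀, hs₀, hmin⟩ := hcomp.exists_isMinOn (NormedSpace.sphere_nonempty.2 hr.le) hcont
  set m := ‖H x₀ s₀‖ with hm
  have hmpos : 0 < m := norm_pos_iff.2 (hne s₀ hs₀)
  have h1 : ∀ᶠ x in 𝓝 x₀, ∀ s ∈ sphere c r, m / 2 < ‖H x s‖ := by
    refine hcomp.eventually_forall_of_forall_eventually fun s hsr => ?_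
    have : m / 2 < ‖H x₀ s‖ := (half_lt_self hmpos).trans_le (hmin hsr)
    exact (hs s hsr).norm.eventually (lt_mem_nhds this)
  have h2 : ∀ᶠ x in 𝓝 x₀, ‖H x c‖ < m / 2 := by
    refine hc.norm.eventually (gt_mem_nhds ?_)
    simpa [h₀] using hmpos
  filter_upwards [hd, h1, h2] with x hdx h1x h2x
  by_contra! hcon
  rw [← closure_ball c hr.ne'] at hcon
  have key := Complex.norm_le_of_forall_mem_frontier_norm_le isBounded_ball (hdx.inv hcon)
    (C := (m / 2)⁻¹) (fun z hz => by
      rw [frontier_ball c hr.ne'] at hz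
      rw [Pi.inv_apply, norm_inv]
      exact inv_anti₀ (by positivity) (h1x z hz).le) (subset_closure (mem_ball_self hr))
  rw [Pi.inv_apply, norm_inv] at key
  have hcpos : 0 < ‖H x c‖ := norm_pos_iff.2 (hcon c (subset_closure (mem_ball_self hr)))
  exact absurd ((inv_le_inv₀ hcpos (by positivity)).1 key) (not_le.2 h2x)

/-- The derivative of an injective holomorphic function of one variable does not vanish. -/
theorem deriv_ne_zero_of_injOn {f : ℂ → ℂ} {U : Set ℂ} (hU : IsOpen U)
    (hf : DifferentiableOn ℂ f U) (hinj : InjOn f U) {a : ℂ} (ha : a ∈ U) : deriv f a ≠ 0 := by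
  intro h0
  obtain ⟨r, hr, hrU⟩ := Metric.nhds_basis_closedBall.mem_iff.1 (hU.mem_nhds ha)
  have hds : ∀ w ∈ U, DifferentiableOn ℂ (dslope f w) U := fun w hw =>
    (Complex.differentiableOn_dslope (hU.mem_nhds hw)).2 hf
  have hslope : ∀ w ∈ U, ∀ z ∈ U, z ≠ w → dslope f w z ≠ 0 := fun w hw z hz hzw => by
    rw [dslope_of_ne _ hzw, slope_def_field]
    exact div_ne_zero (sub_ne_zero.2 fun h => hzw (hinj hz hw h)) (sub_ne_zero.2 hzw)
  have haz : dslope f a a = 0 := by rw [dslope_same, h0]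
  have hsym : (fun w => dslope f w a) = dslope f a := by
    ext w
    rcases eq_or_ne w a with rfl | hw
    · rfl
    · rw [dslope_of_ne _ hw, dslope_of_ne _ hw.symm, slope_comm]
  have hev := eventually_exists_zero_of_ne_zero_on_sphere (H := fun w z => dslope f w z)
    (x₀ := a) (c := a) hr
    (by
      filter_upwards [hU.mem_nhds ha] with w hw
      exact (hds w hw).diffContOnCl_ball hrU)
    haz
    (by
      simp only [hsym]
      exact ((hds a ha).differentiableAt (hU.mem_nhds ha)).continuousAt)
    (by
      intro s hs
      have hsa : s ≠ a := ne_of_mem_sphere hs hr.ne'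
      have hsU : s ∈ U := hrU (sphere_subset_closedBall hs)
      have e : (fun y : ℂ × ℂ => dslope f y.1 y.2) =ᶠ[𝓝 (a, s)]
          fun y => (f y.2 - f y.1) / (y.2 - y.1) := by
        have : ∀ᶠ y : ℂ × ℂ in 𝓝 (a, s), y.2 ≠ y.1 :=
          (isOpen_ne_fun continuous_snd continuous_fst).mem_nhds hsa
        filter_upwards [this] with y hy
        rw [dslope_of_ne _ hy, slope_def_field]
      have c1 : ContinuousAt f a := (hf.differentiableAt (hU.mem_nhds ha)).continuousAt
      have c2 : ContinuousAt f s := (hf.differentiableAt (hU.mem_nhds hsU)).continuousAt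
      refine ContinuousAt.congr ?_ e.symm
      refine ContinuousAt.div ?_ (by fun_prop) (sub_ne_zero.2 hsa)
      exact (ContinuousAt.comp (x := (a, s)) (g := f) (f := Prod.snd) c2 continuousAt_snd).sub
        (ContinuousAt.comp (x := (a, s)) (g := f) (f := Prod.fst) c1 continuousAt_fst))
    (fun s hs => hslope a ha s (hrU (sphere_subset_closedBall hs)) (ne_of_mem_sphere hs hr.ne'))
  have hev2 : ∀ᶠ w in 𝓝 a, w ∈ U ∧ deriv f w = 0 := by
    filter_upwards [hev, hU.mem_nhds ha] with w ⟨s, hs, hs0⟩ hw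
    have : s = w := by
      by_contra hne
      exact hslope w hw s (hrU hs) hne hs0
    rw [this, dslope_same] at hs0
    exact ⟨hw, hs0⟩
  obtain ⟨ρ, hρ, hball⟩ := Metric.eventually_nhds_iff_ball.1 hev2
  have hmem : a + (ρ / 2 : ℝ) ∈ ball a ρ := by
    simp [abs_of_pos hρ, hρ]
  have := isOpen_ball.is_const_of_deriv_eq_zero (convex_ball a ρ).isPreconnected
    (hf.mono fun w hw => (hball w hw).1) (fun w hw => (hball w hw).2) hmem (mem_ball_self hρ)
  have := hinj (hball _ hmem).1 ha this
  simp [hρ.ne'] at this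

/-- An injective holomorphic map into a one-dimensional space has injective derivative. -/
theorem fderiv_injective_of_injOn_of_finrank_eq_one {E F : Type*} [NormedAddCommGroup E]
    [NormedSpace ℂ E] [NormedAddCommGroup F] [NormedSpace ℂ F] [FiniteDimensional ℂ F]
    (hF : Module.finrank ℂ F = 1) {f : E → F} {U : Set E} (hU : IsOpen U)
    (hf : DifferentiableOn ℂ f U) (hinj : InjOn f U) {a : E} (ha : a ∈ U) :
    Function.Injective (fderiv ℂ f a) := by
  refine (injective_iff_map_eq_zero _).2 fun u hu => ?_
  by_contra hu0
  let ℓ : F ≃L[ℂ] ℂ := ContinuousLinearEquiv.ofFinrankEq (by simpa using hF)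
  let L : ℂ → E := fun s => a + s • u
  have hL : Continuous L := by fun_prop
  have hLU : IsOpen (L ⁻¹' U) := hU.preimage hL
  have h0 : (0 : ℂ) ∈ L ⁻¹' U := by simpa [L] using ha
  have hLinj : Function.Injective L := fun s t hst => by
    simpa [L, hu0] using hst
  refine deriv_ne_zero_of_injOn (f := fun s => ℓ (f (L s))) hLU ?_ ?_ h0 ?_
  · exact ℓ.differentiable.comp_differentiableOn
      (hf.comp (Differentiable.differentiableOn (by fun_prop)) fun s hs => hs)
  · exact fun s hs t ht hst => hLinj (hinj hs ht (ℓ.injective hst))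
  · have h1 : HasFDerivAt f (fderiv ℂ f a) (L 0) := by
      simpa [L] using (hf.differentiableAt (hU.mem_nhds ha)).hasFDerivAt
    have h2 : HasDerivAt L u 0 := by
      have h := ((hasDerivAt_id (0 : ℂ)).smul_const u).const_add a
      rwa [one_smul] at h
    have h3 := h1.comp_hasDerivAt 0 h2
    rw [hu] at h3
    exact (ℓ.hasFDerivAt.comp_hasDerivAt 0 h3).deriv.trans (map_zero ℓ)

/-- Directional derivatives of a holomorphic map between finite-dimensional spaces are
holomorphic. -/
theorem differentiableAt_fderiv_apply {E F : Type*} [NormedAddCommGroup E] [NormedSpace ℂ E]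
    [FiniteDimensional ℂ E] [NormedAddCommGroup F] [NormedSpace ℂ F] [FiniteDimensional ℂ F]
    {f : E → F} {U : Set E} (hU : IsOpen U) (hf : DifferentiableOn ℂ f U) {x₀ : E} (hx₀ : x₀ ∈ U)
    (e : E) : DifferentiableAt ℂ (fun x => fderiv ℂ f x e) x₀ := by
  have : CompleteSpace F := FiniteDimensional.complete ℂ F
  have hfx₀ : ContinuousAt f x₀ := (hf.differentiableAt (hU.mem_nhds hx₀)).continuousAt
  obtain ⟨δ, hδ, hball⟩ := Metric.eventually_nhds_iff_ball.1
    ((hU.eventually_mem hx₀).and (hfx₀.eventually_mem (closedBall_mem_nhds (f x₀) one_pos)))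
  obtain ⟨ρ, hρ, hρδ⟩ : ∃ ρ, 0 < ρ ∧ 3 * ρ = δ := ⟨δ / 3, by positivity, by ring⟩
  obtain ⟨R, hR, hRe⟩ : ∃ R, 0 < R ∧ R * ‖e‖ ≤ ρ / 2 := by
    refine ⟨ρ / 2 / (‖e‖ + 1), by positivity, ?_⟩
    rw [div_mul_eq_mul_div, div_le_iff₀ (by positivity)]
    nlinarith [norm_nonneg e]
  have hmem : ∀ x ∈ ball x₀ ρ, ∀ z : ℂ, ‖z‖ ≤ R → x + z • e ∈ ball x₀ (2 * ρ) := by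
    intro x hx z hz
    rw [mem_ball_iff_norm] at hx ⊢
    calc ‖x + z • e - x₀‖ = ‖(x - x₀) + z • e‖ := by congr 1; abel
      _ ≤ ‖x - x₀‖ + ‖z‖ * ‖e‖ := by
        rw [← norm_smul]; exact norm_add_le _ _
      _ < 2 * ρ := by nlinarith [mul_le_mul_of_nonneg_right hz (norm_nonneg e)]
  have hsub : ball x₀ (2 * ρ) ⊆ ball x₀ δ := ball_subset_ball (by linarith)
  have hbound : ∀ y ∈ ball x₀ (2 * ρ), ‖fderiv ℂ f y‖ ≤ 2 / ρ := by
    intro y hy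
    have hyb : ball y ρ ⊆ ball x₀ δ := ball_subset_ball' (by
      rw [mem_ball] at hy; linarith)
    refine Complex.norm_fderiv_le_div_of_mapsTo_ball
      (hf.mono fun z hz => (hball z (hyb hz)).1) ?_ hρ
    intro z hz
    have h1 := (hball z (hyb hz)).2
    have h2 := (hball y (hsub hy)).2
    rw [mem_closedBall] at *
    linarith [dist_triangle_right (f z) (f y) (f x₀)]
  have hdiff : ∀ y ∈ ball x₀ (2 * ρ), HasFDerivAt f (fderiv ℂ f y) y := fun y hy =>
    (hf.differentiableAt (hU.mem_nhds (hball y (hsub hy)).1)).hasFDerivAt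
  let G : E → ℝ → F := fun x θ =>
    deriv (circleMap 0 R) θ • (1 / (circleMap 0 R θ - 0) ^ (1 + 1)) • f (x + circleMap 0 R θ • e)
  let G' : E → ℝ → E →L[ℂ] F := fun x θ =>
    deriv (circleMap 0 R) θ • (1 / (circleMap 0 R θ - 0) ^ (1 + 1)) •
      fderiv ℂ f (x + circleMap 0 R θ • e)
  have hcirc : ∀ θ, ‖circleMap 0 R θ‖ ≤ R := fun θ => by simp [abs_of_pos hR]
  have hGcont : ∀ x ∈ ball x₀ ρ, Continuous (G x) := by
    intro x hx
    have h1 : Continuous fun θ => f (x + circleMap 0 R θ • e) := by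
      refine continuous_iff_continuousAt.2 fun θ => ?_
      exact ContinuousAt.comp (f := fun θ => x + circleMap 0 R θ • e)
        (hdiff _ (hmem x hx _ (hcirc θ))).continuousAt (by fun_prop)
    have h2 : Continuous fun θ => 1 / (circleMap 0 R θ - 0) ^ (1 + 1) := by
      refine continuous_const.div (by fun_prop) fun θ => ?_
      simp [hR.ne']
    have h3 : Continuous fun θ => deriv (circleMap 0 R) θ := by
      simp only [deriv_circleMap]; fun_prop
    exact h3.smul (h2.smul h1)
  have hCauchy : ∀ x ∈ ball x₀ ρ,
      fderiv ℂ f x e = (2 * Real.pi * Complex.I)⁻¹ • ∫ θ in (0)..(2 * Real.pi), G x θ := by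
    intro x hx
    have hd : ∀ z : ℂ, ‖z‖ ≤ R →
        HasDerivAt (fun z : ℂ => f (x + z • e)) (fderiv ℂ f (x + z • e) e) z := fun z hz => by
      refine (hdiff _ (hmem x hx z hz)).comp_hasDerivAt z ?_
      simpa using ((hasDerivAt_id z).smul_const e).const_add x
    have hdc : DiffContOnCl ℂ (fun z : ℂ => f (x + z • e)) (ball 0 R) := by
      refine DifferentiableOn.diffContOnCl_ball (U := closedBall 0 R) (fun z hz => ?_) subset_rfl
      exact (hd z (by simpa using hz)).differentiableAt.differentiableWithinAt
    have key := hdc.circleIntegral_one_div_sub_center_pow_smul hR 1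
    have h0 : iteratedDeriv 1 (fun z : ℂ => f (x + z • e)) 0 = fderiv ℂ f x e := by
      rw [iteratedDeriv_one, (hd 0 (by simpa using hR.le)).deriv]; simp
    rw [h0, Nat.factorial_one, Nat.cast_one, div_one] at key
    have : (2 * Real.pi * Complex.I : ℂ) ≠ 0 := by simp [Real.pi_ne_zero]
    rw [eq_inv_smul_iff₀ this]
    exact key.symm
  have hev : (fun x => fderiv ℂ f x e) =ᶠ[𝓝 x₀]
      fun x => (2 * Real.pi * Complex.I)⁻¹ • ∫ θ in (0)..(2 * Real.pi), G x θ := by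
    filter_upwards [ball_mem_nhds x₀ hρ] with x hx using hCauchy x hx
  refine DifferentiableAt.congr_of_eventuallyEq ?_ hev
  refine DifferentiableAt.const_smul ?_ _
  refine HasFDerivAt.differentiableAt (f' := ∫ θ in (0)..(2 * Real.pi), G' x₀ θ) ?_
  refine intervalIntegral.hasFDerivAt_integral_of_dominated_of_fderiv_le
    (bound := fun _ => R⁻¹ * (2 / ρ)) (ball_mem_nhds x₀ hρ) ?_ ?_ ?_ ?_ (by simp) ?_
  · filter_upwards [ball_mem_nhds x₀ hρ] with x hx using (hGcont x hx).aestronglyMeasurable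
  · exact (hGcont x₀ (mem_ball_self hρ)).intervalIntegrable _ _
  · borelize E
    borelize (E →L[ℂ] F)
    have h1 : Measurable fun θ => fderiv ℂ f (x₀ + circleMap 0 R θ • e) :=
      (measurable_fderiv ℂ f).comp (by fun_prop : Continuous _).measurable
    have : ProperSpace (E →L[ℂ] F) := FiniteDimensional.proper ℂ _
    have h1' : MeasureTheory.StronglyMeasurable fun θ => fderiv ℂ f (x₀ + circleMap 0 R θ • e) :=
      h1.stronglyMeasurable
    have h2 : Measurable fun θ => 1 / (circleMap 0 R θ - 0) ^ (1 + 1) := by fun_prop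
    have h3 : Measurable fun θ => deriv (circleMap 0 R) θ := measurable_deriv _
    exact (h3.stronglyMeasurable.smul (h2.stronglyMeasurable.smul h1')).aestronglyMeasurable
  · refine Eventually.of_forall fun θ _ x hx => ?_
    have := hbound _ (hmem x hx _ (hcirc θ))
    simp only [G', norm_smul]
    have e1 : ‖deriv (circleMap 0 R) θ‖ * ‖1 / (circleMap 0 R θ - 0) ^ (1 + 1)‖ = R⁻¹ := by
      simp [abs_of_pos hR]; field_simp
    rw [← mul_assoc, e1]
    gcongr
  · refine Eventually.of_forall fun θ _ x hx => ?_
    have := (hdiff _ (hmem x hx _ (hcirc θ))).comp x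
      ((hasFDerivAt_id x).add_const (circleMap 0 R θ • e))
    exact (this.const_smul _).const_smul _

/-- A holomorphic map between finite-dimensional spaces is continuously differentiable. -/
theorem contDiffOn_of_differentiableOn_complex {E F : Type*} [NormedAddCommGroup E]
    [NormedSpace ℂ E] [FiniteDimensional ℂ E] [NormedAddCommGroup F] [NormedSpace ℂ F]
    [FiniteDimensional ℂ F] {f : E → F} {U : Set E} (hU : IsOpen U)
    (hf : DifferentiableOn ℂ f U) : ContDiffOn ℂ 1 f U := by
  rw [show (1 : WithTop ℕ∞) = 0 + 1 by simp, contDiffOn_succ_iff_fderiv_of_isOpen hU]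
  refine ⟨hf, by simp, ?_⟩
  rw [contDiffOn_clm_apply]
  intro e
  rw [contDiffOn_zero]
  exact fun x hx => (differentiableAt_fderiv_apply hU hf hx e).continuousAt.continuousWithinAt

section

variable {E : Type*} [NormedAddCommGroup E] [NormedSpace ℂ E] [FiniteDimensional ℂ E]
  {F : Type*} [NormedAddCommGroup F] [NormedSpace ℂ F] [FiniteDimensional ℂ F]

/-- Iterated directional derivatives of a holomorphic function are holomorphic. -/
theorem differentiableOn_iterate_fderiv_apply {h : E → ℂ} {U : Set E} (hU : IsOpen U)
    (hh : DifferentiableOn ℂ h U) (e : E) (k : ℕ) :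
    DifferentiableOn ℂ ((fun g : E → ℂ => fun x => fderiv ℂ g x e)^[k] h) U := by
  induction k with
  | zero => exact hh
  | succ k ih =>
    rw [Function.iterate_succ_apply']
    exact fun x hx => (differentiableAt_fderiv_apply hU ih hx e).differentiableWithinAt

/-- The iterated derivatives along a line are the iterated directional derivatives. -/
theorem iteratedDeriv_comp_line {h : E → ℂ} {U : Set E} (hU : IsOpen U)
    (hh : DifferentiableOn ℂ h U) (p e : E) (k : ℕ) (s : ℂ) (hs : p + s • e ∈ U) :
    iteratedDeriv k (fun s : ℂ => h (p + s • e)) s =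
      (fun g : E → ℂ => fun x => fderiv ℂ g x e)^[k] h (p + s • e) := by
  induction k generalizing s with
  | zero => simp
  | succ k ih =>
    rw [iteratedDeriv_succ, Function.iterate_succ_apply']
    have hcont : ContinuousAt (fun s : ℂ => p + s • e) s := by fun_prop
    have hev : iteratedDeriv k (fun s : ℂ => h (p + s • e)) =ᶠ[𝓝 s] fun s =>
        (fun g : E → ℂ => fun x => fderiv ℂ g x e)^[k] h (p + s • e) := by
      filter_upwards [hcont.eventually_mem (hU.mem_nhds hs)] with t ht using ih t ht
    rw [hev.deriv_eq]
    have hd := (((differentiableOn_iterate_fderiv_apply hU hh e k).differentiableAt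
      (hU.mem_nhds hs)).hasFDerivAt).comp_hasDerivAt s (f := fun s : ℂ => p + s • e) (f' := e)
        (by simpa using ((hasDerivAt_id s).smul_const e).const_add p)
    exact hd.deriv

/-- A holomorphic function on a ball that is nonzero at `x` has a nonzero iterated derivative at the
center in the direction of `x`. -/
theorem exists_iterate_fderiv_apply_ne_zero {h : E → ℂ} {p x : E} {ρ : ℝ}
    (hh : DifferentiableOn ℂ h (ball p ρ)) (hx : x ∈ ball p ρ) (hne : h x ≠ 0) :
    ∃ k, (fun g : E → ℂ => fun y => fderiv ℂ g y (x - p))^[k] h p ≠ 0 := by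
  by_contra! hcon
  have hρ : 0 < ρ := pos_of_mem_ball hx
  set L : ℂ → E := fun s => p + s • (x - p) with hL
  have hS : IsOpen (L ⁻¹' ball p ρ) := isOpen_ball.preimage (by fun_prop)
  have hconv : Convex ℝ (L ⁻¹' ball p ρ) := by
    intro a ha b hb u v hu hv huv
    have hab : L (u • a + v • b) = u • L a + v • L b := by
      have : (p : E) = u • p + v • p := by rw [← add_smul, huv, one_smul]
      simp only [hL, smul_add, add_smul, smul_assoc]
      nth_rewrite 1 [this]
      abel
    rw [mem_preimage, hab]
    exact convex_ball p ρ ha hb hu hv huv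
  have hd : DifferentiableOn ℂ (fun s => h (L s)) (L ⁻¹' ball p ρ) :=
    hh.comp (Differentiable.differentiableOn (by fun_prop)) fun s hs => hs
  have han := hd.analyticOnNhd hS
  have h0 : (0 : ℂ) ∈ L ⁻¹' ball p ρ := by simp [hL, hρ]
  have h1 : (1 : ℂ) ∈ L ⁻¹' ball p ρ := by simpa [hL] using hx
  have htop : analyticOrderAt (fun s => h (L s)) 0 = ⊤ := by
    refine ENat.eq_top_iff_forall_ge.2 fun n => ?_
    rw [natCast_le_analyticOrderAt_iff_iteratedDeriv_eq_zero (han 0 h0)]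
    intro i _
    rw [iteratedDeriv_comp_line isOpen_ball hh p (x - p) i 0 h0]
    simpa using hcon i
  have := han.eqOn_zero_of_preconnected_of_eventuallyEq_zero hconv.isPreconnected h0
    (analyticOrderAt_eq_top.1 htop) h1
  exact hne (by simpa [hL] using this)

/-- The zero set of a holomorphic function of at least two variables that vanishes at `p` but not
identically contains an injective holomorphic curve. -/
theorem exists_curve_in_zero_set (hdim : 1 < Module.finrank ℂ E) {h : E → ℂ} {p x : E} {ρ : ℝ}
    (hh : DifferentiableOn ℂ h (ball p ρ)) (hp : h p = 0) (hx : x ∈ ball p ρ) (hne : h x ≠ 0) :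
    ∃ γ : ℂ → E, Function.Injective γ ∧
      ∀ᶠ t in 𝓝 0, DifferentiableAt ℂ γ t ∧ γ t ∈ ball p ρ ∧ h (γ t) = 0 := by
  classical
  set e := x - p with he
  have he0 : e ≠ 0 := fun h0 => hne (by rw [sub_eq_zero.1 h0, hp])
  obtain ⟨v, hv⟩ : ∃ v, v ∉ Submodule.span ℂ {e} := by
    by_contra! hcon
    have := finrank_span_singleton (K := ℂ) he0
    rw [(Submodule.eq_top_iff'.2 hcon), finrank_top] at this
    omega
  set D : (E → ℂ) → E → ℂ := fun g y => fderiv ℂ g y e with hD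
  have hex : ∃ k, ∃ q ∈ ball p ρ, h q = 0 ∧ D^[k] h q ≠ 0 := by
    obtain ⟨k, hk⟩ := exists_iterate_fderiv_apply_ne_zero hh hx hne
    exact ⟨k, p, mem_ball_self (pos_of_mem_ball hx), hp, hk⟩
  obtain ⟨q, hq, hq0, hqk⟩ := Nat.find_spec hex
  have hmin := fun {k} => Nat.find_min hex (m := k)
  generalize Nat.find hex = m at hqk hmin
  obtain _ | k := m
  · exact absurd hq0 hqk
  rw [Function.iterate_succ_apply'] at hqk
  set g := D^[k] h with hg
  have hgz : ∀ y ∈ ball p ρ, h y = 0 → g y = 0 := fun y hy hy0 => by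
    by_contra hgy
    exact hmin (Nat.lt_succ_self k) ⟨y, hy, hy0, hgy⟩
  have hgd : DifferentiableOn ℂ g (ball p ρ) :=
    differentiableOn_iterate_fderiv_apply isOpen_ball hh e k
  have hgC := contDiffOn_of_differentiableOn_complex isOpen_ball hgd
  let A : ℂ × ℂ → E := fun y => q + y.1 • v + y.2 • e
  have hA0 : A (0, 0) = q := by simp [A]
  have hAc : Continuous A := by fun_prop
  have hgA : ContDiffAt ℂ 1 (fun y => g (A y)) (0, 0) := by
    refine ContDiffAt.comp (0, 0) (g := g) (f := A) ?_ (by fun_prop)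
    rw [hA0]
    exact hgC.contDiffAt (isOpen_ball.mem_nhds hq)
  have hinv : (fderiv ℂ (fun y => g (A y)) (0, 0) ∘L .inr ℂ ℂ ℂ).IsInvertible := by
    have hgq : HasFDerivAt g (fderiv ℂ g q) (A (0, 0)) := by
      rw [hA0]
      exact (hgd.differentiableAt (isOpen_ball.mem_nhds hq)).hasFDerivAt
    have hfA : HasFDerivAt A ((ContinuousLinearMap.fst ℂ ℂ ℂ).smulRight v +
        (ContinuousLinearMap.snd ℂ ℂ ℂ).smulRight e) (0, 0) := by
      exact ((hasFDerivAt_fst.smul_const v).const_add q).add (hasFDerivAt_snd.smul_const e)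
    have h1 := (hgq.comp (0, 0) hfA).fderiv
    have h2 : fderiv ℂ (fun y => g (A y)) (0, 0) ∘L .inr ℂ ℂ ℂ =
        (ContinuousLinearEquiv.unitsEquivAut ℂ (Units.mk0 _ hqk) : ℂ →L[ℂ] ℂ) := by
      rw [show (fun y => g (A y)) = g ∘ A from rfl, h1]
      ext
      simp [D]
    rw [h2]
    exact ContinuousLinearMap.isInvertible_equiv
  set φ := hgA.implicitFunction one_ne_zero hinv with hφ
  have hφ0 : φ 0 = 0 := hgA.implicitFunction_apply_self one_ne_zero hinv
  have hφev : ∀ᶠ y in 𝓝 ((0, 0) : ℂ × ℂ), g (A y) = 0 ↔ φ y.1 = y.2 := by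
    have := hgA.eventually_apply_eq_iff_implicitFunction one_ne_zero hinv
    simpa only [hA0, hgz q hq hq0] using this
  have hφd : ∀ᶠ t in 𝓝 (0 : ℂ), DifferentiableAt ℂ φ t := by
    have := (hgA.contDiffAt_implicitFunction one_ne_zero hinv).eventually (by simp)
    filter_upwards [this] with t ht using ht.differentiableAt one_ne_zero
  have hAev : ∀ᶠ y in 𝓝 ((0, 0) : ℂ × ℂ), A y ∈ ball p ρ :=
    hAc.continuousAt.eventually_mem (by rw [hA0]; exact isOpen_ball.mem_nhds hq)
  obtain ⟨r, hr, hball⟩ := Metric.nhds_basis_closedBall.eventually_iff.1 (hφev.and hAev)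
  have hmem : ∀ t : ℂ, ‖t‖ ≤ r → ∀ s : ℂ, ‖s‖ ≤ r →
      (g (A (t, s)) = 0 ↔ φ t = s) ∧ A (t, s) ∈ ball p ρ := fun t ht s hs =>
    hball (by simp [Prod.dist_eq, ht, hs])
  have hhA : ∀ t : ℂ, ‖t‖ ≤ r → ∀ s : ℂ, ‖s‖ ≤ r →
      DifferentiableAt ℂ (fun y => h (A y)) (t, s) := fun t ht s hs =>
    DifferentiableAt.comp (t, s) (g := h) (f := A)
      (hh.differentiableAt (isOpen_ball.mem_nhds (hmem t ht s hs).2)) (by fun_prop)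
  have hzero : ∀ t : ℂ, ‖t‖ ≤ r → ∀ s : ℂ, ‖s‖ ≤ r → h (A (t, s)) = 0 → φ t = s :=
    fun t ht s hs h0 => (hmem t ht s hs).1.1 (hgz _ (hmem t ht s hs).2 h0)
  have hr0 : ‖(0 : ℂ)‖ ≤ r := by simpa using hr.le
  have hnear : ∀ᶠ t : ℂ in 𝓝 0, ‖t‖ ≤ r := by
    filter_upwards [closedBall_mem_nhds (0 : ℂ) hr] with t ht using by simpa using ht
  have hev := eventually_exists_zero_of_ne_zero_on_sphere (H := fun t s => h (A (t, s)))
    (x₀ := (0 : ℂ)) (c := 0) hr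
    (by
      filter_upwards [hnear] with t ht
      refine DifferentiableOn.diffContOnCl_ball (U := closedBall 0 r) (fun s hs => ?_) subset_rfl
      refine DifferentiableAt.differentiableWithinAt ?_
      exact DifferentiableAt.comp s (g := fun y => h (A y)) (f := fun s => (t, s))
        (hhA t ht s (by simpa using hs)) (by fun_prop))
    (by simpa [hA0] using hq0)
    (ContinuousAt.comp (x := (0 : ℂ)) (g := fun y => h (A y)) (f := fun t => (t, (0 : ℂ)))
      (hhA 0 hr0 0 hr0).continuousAt (by fun_prop))
    (fun s hs => (hhA 0 hr0 s (by simpa using (mem_sphere.1 hs).le)).continuousAt)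
    (fun s hs h0 => by
      have := hzero 0 hr0 s (by simpa using (mem_sphere.1 hs).le) h0
      rw [hφ0] at this
      rw [← this] at hs
      simp [hr.ne] at hs)
  refine ⟨fun t => A (t, φ t), ?_, ?_⟩
  · intro t t' htt
    by_contra hne'
    refine hv (Submodule.mem_span_singleton.2 ⟨(t - t')⁻¹ * (φ t' - φ t), ?_⟩)
    have h1 : (t - t') • v = (φ t' - φ t) • e := by
      simp only [A, add_assoc, add_right_inj] at htt
      rw [sub_smul, sub_smul, sub_eq_sub_iff_add_eq_add, htt, add_comm]
    rw [mul_smul, ← h1, smul_smul, inv_mul_cancel₀ (sub_ne_zero.2 hne'), one_smul]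
  · filter_upwards [hev, hnear, hφd] with t ⟨s, hs, hs0⟩ ht htd
    have hsr : ‖s‖ ≤ r := by simpa using hs
    have hts := hzero t ht s hsr hs0
    refine ⟨by fun_prop, ?_, ?_⟩
    · simpa only [hts] using (hmem t ht s hsr).2
    · simpa only [hts] using hs0

/-- The Jacobian determinant: the critical points are the zeros of a holomorphic function. -/
theorem exists_differentiableOn_eq_zero_iff_not_injective_fderiv
    (hEF : Module.finrank ℂ E = Module.finrank ℂ F) {f : E → F} {U : Set E} (hU : IsOpen U)
    (hf : DifferentiableOn ℂ f U) :
    ∃ h : E → ℂ, DifferentiableOn ℂ h U ∧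
      ∀ x, h x = 0 ↔ ¬ Function.Injective (fderiv ℂ f x) := by
  classical
  let b := Module.finBasis ℂ E
  let b' := (Module.finBasis ℂ F).reindex (finCongr hEF.symm)
  refine ⟨fun x => (LinearMap.toMatrix b b' (fderiv ℂ f x : E →ₗ[ℂ] F)).det, ?_, fun x => ?_⟩
  · have hentry : ∀ i j, DifferentiableOn ℂ
        (fun x => LinearMap.toMatrix b b' (fderiv ℂ f x : E →ₗ[ℂ] F) i j) U := by
      intro i j x hx
      simp only [LinearMap.toMatrix_apply]
      have h1 := differentiableAt_fderiv_apply hU hf hx (b j)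
      exact ((LinearMap.toContinuousLinearMap (b'.coord i)).differentiableAt.comp x
        h1).differentiableWithinAt
    simp only [Matrix.det_apply]
    exact DifferentiableOn.fun_sum fun σ _ =>
      DifferentiableOn.const_smul (fun x hx => (HasFDerivWithinAt.finsetProd fun i _ =>
        (hentry (σ i) i x hx).hasFDerivWithinAt).differentiableWithinAt) _
  · rw [iff_not_comm, ← ne_eq, ← isUnit_iff_ne_zero]
    refine ⟨fun hinj => ?_, fun hunit => ?_⟩
    · exact LinearEquiv.isUnit_det
        (LinearEquiv.ofInjectiveOfFinrankEq (fderiv ℂ f x : E →ₗ[ℂ] F) hinj hEF) b b'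
    · exact (LinearEquiv.ofIsUnitDet hunit).injective

/-- If the derivative of an injective holomorphic map is at every point either injective or zero,
then it is injective everywhere. -/
theorem fderiv_injective_of_injective_or_eq_zero (hE : 1 < Module.finrank ℂ E)
    (hEF : Module.finrank ℂ E = Module.finrank ℂ F)
    {f : E → F} {U : Set E} (hU : IsOpen U) (hf : DifferentiableOn ℂ f U) (hinj : InjOn f U)
    (hor : ∀ x ∈ U, Function.Injective (fderiv ℂ f x) ∨ fderiv ℂ f x = 0) {p : E} (hp : p ∈ U) :
    Function.Injective (fderiv ℂ f p) := by
  by_contra hpn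
  obtain ⟨h, hh, hiff⟩ := exists_differentiableOn_eq_zero_iff_not_injective_fderiv hEF hU hf
  obtain ⟨ρ, hρ, hρU⟩ := Metric.isOpen_iff.1 hU p hp
  obtain ⟨γ, hγ, hev⟩ : ∃ γ : ℂ → E, Function.Injective γ ∧
      ∀ᶠ t in 𝓝 0, DifferentiableAt ℂ γ t ∧ γ t ∈ ball p ρ ∧ h (γ t) = 0 := by
    by_cases hx : ∃ x ∈ ball p ρ, h x ≠ 0
    · obtain ⟨x, hx, hne⟩ := hx
      exact exists_curve_in_zero_set hE (hh.mono hρU) ((hiff p).2 hpn) hx hne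
    · push Not at hx
      have : Nontrivial E := Module.nontrivial_of_finrank_pos (R := ℂ) (by omega)
      obtain ⟨e, he⟩ := exists_ne (0 : E)
      refine ⟨fun t => p + t • e, fun s t hst => by simpa [he] using hst, ?_⟩
      have hc : ContinuousAt (fun t : ℂ => p + t • e) 0 := by fun_prop
      filter_upwards [hc.eventually_mem (by simpa using ball_mem_nhds p hρ)] with t ht
      exact ⟨by fun_prop, ht, hx _ ht⟩
  obtain ⟨δ, hδ, hball⟩ := Metric.eventually_nhds_iff_ball.1 hev
  have hder : ∀ t ∈ ball (0 : ℂ) δ, HasDerivAt (f ∘ γ) 0 t := fun t ht => by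
    obtain ⟨hd, hU', h0⟩ := hball t ht
    have hz : fderiv ℂ f (γ t) = 0 := (hor _ (hρU hU')).resolve_left ((hiff _).1 h0)
    have h1 := (hf.differentiableAt (hU.mem_nhds (hρU hU'))).hasFDerivAt
    rw [hz] at h1
    simpa using h1.comp_hasDerivAt t hd.hasDerivAt
  have hmem : ((δ / 2 : ℝ) : ℂ) ∈ ball (0 : ℂ) δ := by simp [abs_of_pos hδ, hδ]
  have hmem0 := mem_ball_self (x := (0 : ℂ)) hδ
  have hconst := isOpen_ball.is_const_of_deriv_eq_zero (convex_ball 0 δ).isPreconnected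
    (fun t ht => (hder t ht).differentiableAt.differentiableWithinAt)
    (fun t ht => (hder t ht).deriv) hmem hmem0
  have := hγ (hinj (hρU (hball _ hmem).2.1) (hρU (hball _ hmem0).2.1) hconst)
  simp [hδ.ne'] at this

end

/-- **Osgood's theorem**: an injective holomorphic map between spaces of equal finite dimension has
injective derivative. -/
theorem fderiv_injective_of_injOn (n : ℕ) : ∀ {E : Type*} [NormedAddCommGroup E]
    [NormedSpace ℂ E] [FiniteDimensional ℂ E] {F : Type*} [NormedAddCommGroup F]
    [NormedSpace ℂ F] [FiniteDimensional ℂ F],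
    Module.finrank ℂ E = n → Module.finrank ℂ F = n → ∀ {f : E → F} {U : Set E}, IsOpen U →
    DifferentiableOn ℂ f U → InjOn f U → ∀ {a : E}, a ∈ U →
    Function.Injective (fderiv ℂ f a) := by
  induction n with
  | zero =>
    intro E _ _ _ F _ _ _ hE hF f U hU hf hinj a ha
    have := Module.finrank_zero_iff.1 hE
    exact Function.injective_of_subsingleton _
  | succ n ih =>
    intro E _ _ _ F _ _ _ hE hF f U hU hf hinj a ha
    rcases Nat.eq_zero_or_pos n with rfl | hn
    · exact fderiv_injective_of_injOn_of_finrank_eq_one hF hU hf hinj ha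
    refine fderiv_injective_of_injective_or_eq_zero (by omega) (hE.trans hF.symm) hU hf hinj ?_ ha
    clear ha a
    intro a ha
    rw [or_iff_not_imp_right]
    intro hne
    obtain ⟨v, hv⟩ : ∃ v, fderiv ℂ f a v ≠ 0 := by
      by_contra! hcon
      exact hne (ContinuousLinearMap.ext hcon)
    set T := fderiv ℂ f a with hT
    obtain ⟨ℓ, hℓ⟩ : ∃ ℓ : F →L[ℂ] ℂ, ℓ (T v) = 1 := by
      obtain ⟨ℓ₀, hℓ₀⟩ := SeparatingDual.exists_eq_one (R := ℂ) hv
      exact ⟨ℓ₀, hℓ₀⟩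
    set K := LinearMap.ker ((ℓ ∘L T : E →L[ℂ] ℂ) : E →ₗ[ℂ] ℂ) with hK
    set M := LinearMap.ker (ℓ : F →ₗ[ℂ] ℂ) with hM
    have hKn : Module.finrank ℂ K = n := by
      have : ((ℓ ∘L T : E →L[ℂ] ℂ) : Module.Dual ℂ E) ≠ 0 := fun h0 => by
        have := LinearMap.congr_fun h0 v
        simp [hℓ] at this
      have := Module.Dual.finrank_ker_add_one_of_ne_zero this
      rw [hE] at this
      exact Nat.succ_injective this
    have hMn : Module.finrank ℂ M = n := by
      have : (ℓ : Module.Dual ℂ F) ≠ 0 := fun h0 => by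
        have := LinearMap.congr_fun h0 (T v)
        simp [hℓ] at this
      have := Module.Dual.finrank_ker_add_one_of_ne_zero this
      rw [hF] at this
      exact Nat.succ_injective this
    have hTa : HasFDerivAt f T a := (hf.differentiableAt (hU.mem_nhds ha)).hasFDerivAt
    let B : K × ℂ →L[ℂ] E := K.subtypeL ∘L .fst ℂ K ℂ + (ContinuousLinearMap.snd ℂ K ℂ).smulRight v
    have hB : ∀ k s, B (k, s) = k + s • v := fun k s => by simp [B]
    let G : K × ℂ → ℂ := fun y => ℓ (f (a + B y))
    have hGT : HasFDerivAt G (ℓ ∘L T ∘L B) (0, 0) := by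
      have h1 : HasFDerivAt f T (a + B (0, 0)) := by simpa [hB] using hTa
      exact ℓ.hasFDerivAt.comp (0, 0)
        (h1.comp (f := fun y => a + B y) (0, 0) (B.hasFDerivAt.const_add a))
    have hG : ContDiffAt ℂ 1 G (0, 0) := by
      refine ℓ.contDiff.contDiffAt.comp (0, 0) ?_
      refine ContDiffAt.comp (0, 0) (g := f) (f := fun y => a + B y) ?_ (by fun_prop)
      simpa [hB] using (contDiffOn_of_differentiableOn_complex hU hf).contDiffAt (hU.mem_nhds ha)
    have hinv : (fderiv ℂ G (0, 0) ∘L .inr ℂ K ℂ).IsInvertible := by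
      have : fderiv ℂ G (0, 0) ∘L .inr ℂ K ℂ = (ContinuousLinearEquiv.refl ℂ ℂ : ℂ →L[ℂ] ℂ) := by
        rw [hGT.fderiv]
        ext
        simp [hB, hℓ]
      rw [this]
      exact ContinuousLinearMap.isInvertible_equiv
    set φ := hG.implicitFunction one_ne_zero hinv with hφ
    have hφ0 : φ 0 = 0 := hG.implicitFunction_apply_self one_ne_zero hinv
    have hφ' : HasFDerivAt φ (0 : K →L[ℂ] ℂ) 0 := by
      have := (hG.hasStrictFDerivAt_implicitFunction one_ne_zero hinv).hasFDerivAt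
      have h0 : fderiv ℂ G (0, 0) ∘L .inl ℂ K ℂ = 0 := by
        rw [hGT.fderiv]
        ext k
        have hk : ℓ (T k) = 0 := k.2
        simpa [hB] using hk
      rw [h0, ContinuousLinearMap.comp_zero] at this
      simpa using this
    have hφd : ∀ᶠ k in 𝓝 (0 : K), DifferentiableAt ℂ φ k := by
      have := (hG.contDiffAt_implicitFunction one_ne_zero hinv).eventually (by simp)
      filter_upwards [this] with t ht using ht.differentiableAt one_ne_zero
    have hφG : ∀ᶠ k in 𝓝 (0 : K), G (k, φ k) = G (0, 0) :=
      hG.eventually_apply_implicitFunction one_ne_zero hinv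
    let σ : K → E := fun k => a + B (k, φ k)
    have hσ0 : σ 0 = a := by simp [σ, hφ0, hB]
    have hσd : ∀ k, DifferentiableAt ℂ φ k → DifferentiableAt ℂ σ k := fun k hk => by fun_prop
    have hσU : ∀ᶠ k in 𝓝 (0 : K), σ k ∈ U :=
      (hσd 0 hφ'.differentiableAt).continuousAt.eventually_mem (by
        rw [hσ0]; exact hU.mem_nhds ha)
    obtain ⟨δ, hδ, hball⟩ := Metric.eventually_nhds_iff_ball.1 (hφd.and (hφG.and hσU))
    have hσinj : Function.Injective σ := by
      intro k k' hkk
      have h1 : B (k, φ k) = B (k', φ k') := by simpa [σ] using hkk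
      have h2 := congrArg (fun x => ℓ (T x)) h1
      have hk0 : ℓ (T k) = 0 := k.2
      have hk0' : ℓ (T k') = 0 := k'.2
      have h3 : φ k = φ k' := by simpa [hB, hℓ, hk0, hk0'] using h2
      rw [hB, hB, h3] at h1
      exact Subtype.ext (add_right_cancel h1)
    let P : F →L[ℂ] M := (ContinuousLinearMap.id ℂ F - ℓ.smulRight (T v)).codRestrict M
      fun y => by simp [M, hℓ]
    have hP : ∀ y, (P y : F) = y - ℓ y • T v := fun y => by simp [P]
    have hfσd : ∀ k ∈ ball (0 : K) δ, DifferentiableAt ℂ (fun k => P (f (σ k))) k := fun k hk => by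
      obtain ⟨hd, -, hkU⟩ := hball k hk
      exact P.differentiableAt.comp k
        ((hf.differentiableAt (hU.mem_nhds hkU)).comp k (hσd k hd))
    have key := ih hKn hMn (f := fun k => P (f (σ k))) isOpen_ball
      (fun k hk => (hfσd k hk).differentiableWithinAt)
      (by
        intro k hk k' hk' hkk
        obtain ⟨-, hGk, hkU⟩ := hball k hk
        obtain ⟨-, hGk', hkU'⟩ := hball k' hk'
        have h1 : ℓ (f (σ k)) = ℓ (f (σ k')) := hGk.trans hGk'.symm
        have h2 : (P (f (σ k)) : F) = P (f (σ k')) := congrArg _ hkk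
        rw [hP, hP, h1] at h2
        exact hσinj (hinj hkU hkU' (sub_left_injective h2)))
      (mem_ball_self hδ)
    have hder : HasFDerivAt (fun k => P (f (σ k))) (P ∘L T ∘L K.subtypeL) 0 := by
      have h1 : HasFDerivAt f T (σ 0) := by rwa [hσ0]
      have h2 : HasFDerivAt σ K.subtypeL 0 := by
        have := (B.hasFDerivAt.comp (0 : K) ((hasFDerivAt_id (0 : K)).prodMk hφ')).const_add a
        have e : B ∘L (ContinuousLinearMap.id ℂ K).prod 0 = K.subtypeL := by
          ext k
          simp [hB]
        rw [e] at this
        exact this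
      exact P.hasFDerivAt.comp 0 (h1.comp 0 h2)
    rw [hder.fderiv] at key
    refine (injective_iff_map_eq_zero _).2 fun u hu => ?_
    have huK : u ∈ K := by simp [K, hu]
    have := (injective_iff_map_eq_zero _).1 key ⟨u, huK⟩ (by simp [hu])
    simpa using this

/-- The inverse of a holomorphic bijection between open sets is holomorphic. -/
theorem differentiableOn_invFunOn {E : Type*} [NormedAddCommGroup E] [NormedSpace ℂ E]
    [FiniteDimensional ℂ E] {f : E → E} {U V : Set E} (hU : IsOpen U) (hV : IsOpen V)
    (hf : DifferentiableOn ℂ f U) (hbij : BijOn f U V) :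
    DifferentiableOn ℂ (Function.invFunOn f U) V := by
  have : CompleteSpace E := FiniteDimensional.complete ℂ E
  obtain ⟨hleft, hright⟩ := hbij.invOn_invFunOn
  intro w hw
  obtain ⟨a, ha, rfl⟩ := hbij.surjOn hw
  have hinj := fderiv_injective_of_injOn _ rfl rfl hU hf hbij.injOn ha
  let e : E ≃L[ℂ] E :=
    (LinearEquiv.ofInjectiveEndo (fderiv ℂ f a : E →ₗ[ℂ] E) hinj).toContinuousLinearEquiv
  have hstrict : HasStrictFDerivAt f (e : E →L[ℂ] E) a :=
    ((contDiffOn_of_differentiableOn_complex hU hf).contDiffAt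
      (hU.mem_nhds ha)).hasStrictFDerivAt one_ne_zero
  have hcont : ContinuousAt (Function.invFunOn f U) (f a) := by
    intro W hW
    rw [hleft ha] at hW
    rw [← hstrict.map_nhds_eq_of_equiv, mem_map, mem_map]
    filter_upwards [hW, hU.mem_nhds ha] with z hz hzU
    rwa [mem_preimage, mem_preimage, hleft hzU]
  refine (HasFDerivAt.of_local_left_inverse (f := f) (f' := e) hcont ?_ ?_).differentiableAt
    |>.differentiableWithinAt
  · rw [hleft ha]
    exact hstrict.hasFDerivAt
  · filter_upwards [hV.mem_nhds hw] with y hy using hright hy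

end

/-- If `Ω ⊆ ℂⁿ` is a bounded domain (nonempty open connected set) and
`Φ : Ω → Ω` is a holomorphic bijection of `Ω` onto itself, then the inverse
map is holomorphic. -/
theorem holomorphic_inverse_of_automorphism (n : ℕ) (Ω : Set (Fin n → ℂ))
    (hopen : IsOpen Ω) (hconn : IsConnected Ω) (hbdd : Bornology.IsBounded Ω)
    (Φ : (Fin n → ℂ) → (Fin n → ℂ))
    (hΦ : DifferentiableOn ℂ Φ Ω) (hbij : Set.BijOn Φ Ω Ω) :
    ∃ Ψ : (Fin n → ℂ) → (Fin n → ℂ), DifferentiableOn ℂ Ψ Ω ∧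
      (∀ z ∈ Ω, Ψ (Φ z) = z) ∧ (∀ z ∈ Ω, Φ (Ψ z) = z) := by
  exact ⟨Function.invFunOn Φ Ω, differentiableOn_invFunOn hopen hopen hΦ hbij,
    hbij.invOn_invFunOn.1, hbij.invOn_invFunOn.2⟩
end

section
/- Let Ω ⊆ ℂⁿ be a bounded domain whose automorphism group is compact in the compact-open topology on C(Ω, ℂⁿ). Then for every ε > 0 there exists δ > 0 such that for every automorphism α of Ω and every p ∈ Ω with dist(p, ∂Ω) ≤ δ, one has dist(α(p), ∂Ω) ≤ ε, where dist(·, ∂Ω) denotes Euclidean distance to the topological frontier of Ω. -/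
/-- The subset of `C(Ω, ℂⁿ)` (with the compact-open topology) consisting of the
restrictions to `Ω` of the holomorphic automorphisms of `Ω`. -/
def AutRestrictions (n : ℕ) (Ω : Set (Fin n → ℂ)) : Set C(↥Ω, Fin n → ℂ) :=
  {f | ∃ φ : (Fin n → ℂ) → (Fin n → ℂ),
    DifferentiableOn ℂ φ Ω ∧ Set.BijOn φ Ω Ω ∧ ∀ z : ↥Ω, f z = φ ↑z}

/-- In a compact family of continuous bijective self-maps of a Hausdorff space that is closed
under composition, every member has a left inverse in the family. -/
theorem ContinuousMap.exists_comp_eq_id_of_isCompact {X : Type*} [TopologicalSpace X] [T2Space X]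
    {S : Set C(X, X)} (hS : IsCompact S) (hcomp : ∀ f ∈ S, ∀ g ∈ S, f.comp g ∈ S)
    (hbij : ∀ f ∈ S, Function.Bijective f) {f : C(X, X)} (hf : f ∈ S) :
    ∃ g ∈ S, g.comp f = ContinuousMap.id X := by
  let : Semigroup C(X, X) :=
    { mul := fun f g => f.comp g
      mul_assoc := fun _ _ _ => rfl }
  obtain ⟨e, ⟨g, hg, rfl⟩, he⟩ := exists_idempotent_in_compact_subsemigroup
    (fun r : C(X, X) => ContinuousMap.continuous_precomp r)
    ((fun g : C(X, X) => g.comp f) '' S) ⟨_, f, hf, rfl⟩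
    (hS.image (ContinuousMap.continuous_precomp f)) (by
      rintro _ ⟨a, ha, rfl⟩ _ ⟨b, hb, rfl⟩
      exact ⟨(a.comp f).comp b, hcomp _ (hcomp _ ha _ hf) _ hb, rfl⟩)
  refine ⟨g, hg, ContinuousMap.ext fun x => ?_⟩
  exact (hbij _ (hcomp _ hg _ hf)).injective (DFunLike.congr_fun he x)

/-- The automorphisms of `Ω`, regarded as continuous self-maps of `Ω`. -/
def autSelfMaps (n : ℕ) (Ω : Set (Fin n → ℂ)) : Set C(↥Ω, ↥Ω) :=
  {f | ∃ φ : (Fin n → ℂ) → (Fin n → ℂ),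
    DifferentiableOn ℂ φ Ω ∧ Set.BijOn φ Ω Ω ∧ ∀ z : ↥Ω, (f z : Fin n → ℂ) = φ ↑z}

section autSelfMaps

variable {n : ℕ} {Ω : Set (Fin n → ℂ)}

theorem isCompact_autSelfMaps (h : IsCompact (AutRestrictions n Ω)) :
    IsCompact (autSelfMaps n Ω) := by
  have hind : Topology.IsInducing
      (fun f : C(↥Ω, ↥Ω) => (⟨Subtype.val, continuous_subtype_val⟩ : C(↥Ω, Fin n → ℂ)).comp f) :=
    ContinuousMap.isInducing_postcomp _ Topology.IsInducing.subtypeVal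
  rw [hind.isCompact_iff]
  convert h
  ext f
  constructor
  · rintro ⟨g, ⟨φ, hd, hb, hφ⟩, rfl⟩
    exact ⟨φ, hd, hb, hφ⟩
  · rintro ⟨φ, hd, hb, hφ⟩
    have hmem : ∀ z : ↥Ω, f z ∈ Ω := fun z => hφ z ▸ hb.mapsTo z.2
    exact ⟨⟨fun z => ⟨f z, hmem z⟩, f.continuous.subtype_mk hmem⟩, ⟨φ, hd, hb, hφ⟩, rfl⟩

theorem comp_mem_autSelfMaps {f g : C(↥Ω, ↥Ω)} (hf : f ∈ autSelfMaps n Ω)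
    (hg : g ∈ autSelfMaps n Ω) : f.comp g ∈ autSelfMaps n Ω := by
  obtain ⟨φ, hφd, hφb, hφ⟩ := hf
  obtain ⟨ψ, hψd, hψb, hψ⟩ := hg
  exact ⟨φ ∘ ψ, hφd.comp hψd hψb.mapsTo, hφb.comp hψb, fun z => by simp [hφ, hψ]⟩

theorem bijective_of_mem_autSelfMaps {f : C(↥Ω, ↥Ω)} (hf : f ∈ autSelfMaps n Ω) :
    Function.Bijective f := by
  obtain ⟨φ, -, hb, hφ⟩ := hf
  refine ⟨fun x y hxy => Subtype.ext (hb.injOn x.2 y.2 ?_), fun y => ?_⟩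
  · rw [← hφ, ← hφ, hxy]
  · obtain ⟨x, hx, hxy⟩ := hb.surjOn y.2
    exact ⟨⟨x, hx⟩, Subtype.ext ((hφ _).trans hxy)⟩

end autSelfMaps

/-- The points of a bounded set `Ω` at distance at least `ε > 0` from the frontier form a
compact set. -/
theorem isCompact_setOf_le_infDist_frontier {E : Type*} [PseudoMetricSpace E] [ProperSpace E]
    {Ω : Set E} (hbdd : Bornology.IsBounded Ω) {ε : ℝ} (hε : 0 < ε) :
    IsCompact {z : ↥Ω | ε ≤ Metric.infDist (z : E) (frontier Ω)} := by
  rw [Subtype.isCompact_iff]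
  have hclosed : IsClosed {z : E | ε ≤ Metric.infDist z (frontier Ω)} :=
    isClosed_le continuous_const (Metric.continuous_infDist_pt _)
  convert hbdd.isCompact_closure.inter_right hclosed using 1
  ext z
  constructor
  · rintro ⟨w, hw, rfl⟩
    exact ⟨subset_closure w.2, hw⟩
  · rintro ⟨hz, hle⟩
    by_cases hzΩ : z ∈ Ω
    · exact ⟨⟨z, hzΩ⟩, hle, rfl⟩
    · have hfr : z ∈ frontier Ω := ⟨hz, fun h => hzΩ (interior_subset h)⟩
      have : ε ≤ Metric.infDist z (frontier Ω) := hle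
      rw [Metric.infDist_zero_of_mem hfr] at this
      exact absurd this hε.not_ge

/-- If `Ω ⊆ ℂⁿ` is a bounded domain with compact automorphism group, then for every
`ε > 0` there is `δ > 0` such that every automorphism maps points within distance `δ`
of the boundary to points within distance `ε` of the boundary. -/
theorem boundary_dist_small_of_compact_aut (n : ℕ) (Ω : Set (Fin n → ℂ))
    (hopen : IsOpen Ω) (hconn : IsConnected Ω) (hbdd : Bornology.IsBounded Ω)
    (hcomp : IsCompact (AutRestrictions n Ω)) (ε : ℝ) (hε : 0 < ε) :
    ∃ δ > 0, ∀ α : (Fin n → ℂ) → (Fin n → ℂ),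
      DifferentiableOn ℂ α Ω → Set.BijOn α Ω Ω →
      ∀ p ∈ Ω, Metric.infDist p (frontier Ω) ≤ δ →
        Metric.infDist (α p) (frontier Ω) ≤ ε := by
  rcases (frontier Ω).eq_empty_or_nonempty with hfr | hfr
  · exact ⟨1, one_pos, fun α _ _ p _ _ => by simp [hfr, hε.le]⟩
  have : LocallyCompactSpace ↥Ω := hopen.locallyCompactSpace
  have hS := isCompact_autSelfMaps hcomp
  have hT : IsCompact ((fun q : C(↥Ω, ↥Ω) × ↥Ω => q.1 q.2) '' (autSelfMaps n Ω ×ˢ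
      {z : ↥Ω | ε ≤ Metric.infDist (z : Fin n → ℂ) (frontier Ω)})) :=
    (hS.prod (isCompact_setOf_le_infDist_frontier hbdd hε)).image continuous_eval
  have hpos : ∀ z : ↥Ω, 0 < Metric.infDist (z : Fin n → ℂ) (frontier Ω) := fun z =>
    (isClosed_frontier.notMem_iff_infDist_pos hfr).1 fun h =>
      (hopen.frontier_eq ▸ h).2 z.2
  obtain ⟨δ, hδ, hle⟩ := hT.exists_forall_le' (a := 0)
    ((Metric.continuous_infDist_pt (frontier Ω)).comp continuous_subtype_val).continuousOn
    fun z _ => hpos z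
  refine ⟨δ / 2, half_pos hδ, fun α hd hb p hp hpδ => ?_⟩
  by_contra! hlt
  let f : C(↥Ω, ↥Ω) := ⟨hb.mapsTo.restrict, hd.continuousOn.mapsToRestrict hb.mapsTo⟩
  obtain ⟨g, hg, hgf⟩ := ContinuousMap.exists_comp_eq_id_of_isCompact hS
    (fun _ hf _ hg => comp_mem_autSelfMaps hf hg) (fun _ => bijective_of_mem_autSelfMaps)
    (show f ∈ autSelfMaps n Ω from ⟨α, hd, hb, fun _ => rfl⟩)
  have hδp : δ ≤ Metric.infDist p (frontier Ω) :=
    hle ⟨p, hp⟩ ⟨(g, f ⟨p, hp⟩), ⟨hg, hlt.le⟩, DFunLike.congr_fun hgf ⟨p, hp⟩⟩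
  linarith
end
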